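/- For any 𝐦 ∈ ℤ_{≥0}^{n−1} and M ∈ ℤ_{≥0}: if x ∈ S_{𝐦,M+1} and x ∉ S_{𝐦,M}, then there exists δ ∈ P with x_δ ≥ 1 such that the point x − 𝟙_δ (obtained from x by decreasing the coordinate at δ by 1) belongs to S_{𝐦,M}. Equivalently, S_{𝐦,M} + S_{𝟎,1} = S_{𝐦,M+1}. -/

import Mathlib

open scoped Pointwise

/-- The poset `P` of pairs `(i,j)` with `1 ≤ j < i ≤ n` (componentwise order). -/
def posetP (n : ℕ) : Finset (ℕ × ℕ) :=
  (Finset.range (n + 1) ×ˢ Finset.range (n + 1)).filter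
    (fun p => 1 ≤ p.2 ∧ p.2 < p.1 ∧ p.1 ≤ n)

/-- The subposet `P_d = {(i,j) ∈ P : i > d ≥ j}`. -/
def posetPd (n d : ℕ) : Finset (ℕ × ℕ) :=
  (posetP n).filter (fun p => d < p.1 ∧ p.2 ≤ d)

/-- The width of a finite subset of `ℕ × ℕ` (with the componentwise order):
the maximal cardinality of an antichain contained in it. -/
noncomputable def finWidth (Q : Finset (ℕ × ℕ)) : ℕ :=
  sSup (Finset.card '' {A : Finset (ℕ × ℕ) |
    A ⊆ Q ∧ IsAntichain (· ≤ ·) (A : Set (ℕ × ℕ))})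

/-- The polytope `X_{𝐦,M} ⊆ ℝ_{≥0}^P`, realized as the set of functions `ℕ × ℕ → ℝ`
supported on `P`, with nonnegative coordinates, satisfying for every `P' ⊆ P` the
inequality `Σ_{α ∈ P'} x_α ≤ M + Σ_{d=1}^{n-1} m_d · w(P' ∩ P_d)`. -/
def polytopeX (n : ℕ) (m : ℕ → ℕ) (M : ℕ) : Set (ℕ × ℕ → ℝ) :=
  {x | (∀ α, α ∉ posetP n → x α = 0) ∧ (∀ α, 0 ≤ x α) ∧
    ∀ P' ⊆ posetP n,
      ∑ α ∈ P', x α ≤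
        (M : ℝ) + ∑ d ∈ Finset.Icc 1 (n - 1), (m d : ℝ) * (finWidth (P' ∩ posetPd n d) : ℝ)}

/-- `S_{𝐦,M} = X_{𝐦,M} ∩ ℤ^P`: the set of integer points of the polytope. -/
def latticeS (n : ℕ) (m : ℕ → ℕ) (M : ℕ) : Set (ℕ × ℕ → ℤ) :=
  {x | (fun α => (x α : ℝ)) ∈ polytopeX n m M}

/-- An antichain contained in `Q` has at most `finWidth Q` elements. -/
lemma card_le_finWidth {Q A : Finset (ℕ × ℕ)} (hA : A ⊆ Q)
    (hanti : IsAntichain (· ≤ ·) (A : Set (ℕ × ℕ))) : A.card ≤ finWidth Q := by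
  refine le_csSup ⟨Q.card, ?_⟩ ⟨A, ⟨hA, hanti⟩, rfl⟩
  rintro _ ⟨B, ⟨hB, -⟩, rfl⟩
  exact Finset.card_le_card hB

/-- The width of `Q` is attained by some antichain. -/
lemma exists_antichain_card_eq_finWidth (Q : Finset (ℕ × ℕ)) :
    ∃ A ⊆ Q, IsAntichain (· ≤ ·) (A : Set (ℕ × ℕ)) ∧ A.card = finWidth Q := by
  have hne : (Finset.card '' {A : Finset (ℕ × ℕ) |
      A ⊆ Q ∧ IsAntichain (· ≤ ·) (A : Set (ℕ × ℕ))}).Nonempty :=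
    ⟨0, ∅, by simp, rfl⟩
  obtain ⟨A, ⟨hA, hanti⟩, hcard⟩ := Nat.sSup_mem hne ⟨Q.card, by
    rintro _ ⟨B, ⟨hB, -⟩, rfl⟩
    exact Finset.card_le_card hB⟩
  exact ⟨A, hA, hanti, hcard⟩

lemma finWidth_mono {Q Q' : Finset (ℕ × ℕ)} (h : Q ⊆ Q') : finWidth Q ≤ finWidth Q' := by
  obtain ⟨A, hA, hanti, hcard⟩ := exists_antichain_card_eq_finWidth Q
  exact hcard ▸ card_le_finWidth (hA.trans h) hanti

lemma finWidth_insert_le (a : ℕ × ℕ) (Q : Finset (ℕ × ℕ)) :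
    finWidth (insert a Q) ≤ finWidth Q + 1 := by
  obtain ⟨A, hA, hanti, hcard⟩ := exists_antichain_card_eq_finWidth (insert a Q)
  have h := card_le_finWidth (Q := Q) (A := A.erase a) (by grind)
    (hanti.subset (by simp))
  have := Finset.pred_card_le_card_erase (s := A) (a := a)
  omega

/-- Adding an element incomparable to all of `Q` increases the width. -/
lemma finWidth_add_one_le {Q Q' : Finset (ℕ × ℕ)} {b : ℕ × ℕ} (hQ : Q ⊆ Q') (hb : b ∈ Q')
    (h : ∀ u ∈ Q, ¬ u ≤ b ∧ ¬ b ≤ u) : finWidth Q + 1 ≤ finWidth Q' := by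
  obtain ⟨A, hA, hanti, hcard⟩ := exists_antichain_card_eq_finWidth Q
  have hbA : b ∉ A := fun hmem => (h b (hA hmem)).1 le_rfl
  rw [← hcard, ← Finset.card_insert_of_notMem hbA]
  refine card_le_finWidth (Finset.insert_subset hb (hA.trans hQ)) ?_
  rw [Finset.coe_insert]
  exact hanti.insert (fun u hu _ => (h u (hA hu)).1) (fun u hu _ => (h u (hA hu)).2)

open Classical in
/-- An injection `τ` splits `Q` into ascending chains, and the width is at most the number of
their last elements. -/
lemma finWidth_le_card_chain_ends (Q : Finset (ℕ × ℕ)) (τ : ℕ × ℕ → ℕ × ℕ)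
    (hτ : Function.Injective τ) :
    finWidth Q ≤ (Q.filter fun a => ¬ (τ a ∈ Q ∧ a < τ a)).card := by
  obtain ⟨A, hA, hanti, hcard⟩ := exists_antichain_card_eq_finWidth Q
  set U := Q.filter fun b => ∃ a ∈ A, a ≤ b
  have hAU : A ⊆ U := fun a ha => Finset.mem_filter.2 ⟨hA ha, a, ha, le_rfl⟩
  have hstep : (U.filter fun a => τ a ∈ Q ∧ a < τ a).card ≤ (U \ A).card := by
    refine Finset.card_le_card_of_injOn τ ?_ hτ.injOn
    intro b hb
    obtain ⟨hbU, hτQ, hlt⟩ := Finset.mem_filter.1 hb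
    obtain ⟨hbQ, a, ha, hab⟩ := Finset.mem_filter.1 hbU
    refine Finset.mem_sdiff.2 ⟨Finset.mem_filter.2 ⟨hτQ, a, ha, hab.trans hlt.le⟩, fun hmem => ?_⟩
    have hlt' := hab.trans_lt hlt
    exact hanti ha hmem hlt'.ne hlt'.le
  have hsplit := Finset.card_filter_add_card_filter_not (s := U) (fun a => τ a ∈ Q ∧ a < τ a)
  have hsub : (U.filter fun a => ¬ (τ a ∈ Q ∧ a < τ a)).card ≤
      (Q.filter fun a => ¬ (τ a ∈ Q ∧ a < τ a)).card :=
    Finset.card_le_card (Finset.filter_subset_filter _ (Finset.filter_subset _ _))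
  have hsd := Finset.card_sdiff_add_card_eq_card hAU
  omega

open Classical in
/-- A subset of `P` can be split into ascending chains that restrict, for every `d`, to a chain
decomposition of its part in `P_d` with at most as many chains as the width of that part. -/
lemma exists_perm_card_chain_ends_le (n : ℕ) (A : Finset (ℕ × ℕ)) (hAP : A ⊆ posetP n) :
    ∃ σ : Equiv.Perm (ℕ × ℕ), (∀ a ∉ A, σ a = a) ∧ ∀ d,
      ((A ∩ posetPd n d).filter fun a => ¬ (σ a ∈ A ∩ posetPd n d ∧ a < σ a)).card ≤
        finWidth (A ∩ posetPd n d) := by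
  set h : ℕ × ℕ → ℕ := fun b => finWidth (A.filter fun u => u.2 < b.2 ∧ b.1 < u.1)
  have h_lt : ∀ u ∈ A, ∀ b, u.2 < b.2 → b.1 < u.1 → h u < h b := by
    intro u hu b h1 h2
    refine finWidth_add_one_le (b := u) ?_ (by simp [hu, h1, h2]) ?_
    · intro v hv
      simp only [Finset.mem_filter] at hv ⊢
      exact ⟨hv.1, by omega, by omega⟩
    · intro v hv
      simp only [Finset.mem_filter] at hv
      simp only [Prod.le_def]
      omega
  have h_total : ∀ a ∈ A, ∀ b ∈ A, h a = h b → a ≤ b ∨ b ≤ a := by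
    intro a ha b hb hab
    by_contra hcon
    simp only [Prod.le_def] at hcon
    by_cases h1 : a.2 < b.2
    · have := h_lt a ha b h1 (by omega)
      omega
    · have := h_lt b hb a (by omega) (by omega)
      omega
  set C : ℕ × ℕ → Finset (ℕ × ℕ) := fun a => A.filter fun b => h b = h a ∧ a < b
  have h_next : ∀ a : A, ∃ b, (C a).Nonempty → b ∈ C a ∧ ∀ c ∈ C a, b ≤ c := by
    intro a
    by_cases hne : (C a).Nonempty
    · obtain ⟨b, hb⟩ := (C a).exists_minimal hne
      refine ⟨b, fun _ => ⟨hb.prop, fun c hc => ?_⟩⟩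
      have hb' := Finset.mem_filter.1 hb.prop
      have hc' := Finset.mem_filter.1 hc
      rcases h_total b hb'.1 c hc'.1 (hb'.2.1.trans hc'.2.1.symm) with hle | hle
      · exact hle
      · exact hb.le_of_le hc hle
    · exact ⟨0, fun hcon => absurd hcon hne⟩
  choose next hnext using h_next
  have h_inj : ∀ a b : A, (C a).Nonempty → (C b).Nonempty → next a = next b → ¬ a < b := by
    intro a b hCa hCb heq hlt
    obtain ⟨ha, hmin⟩ := hnext a hCa
    obtain ⟨hb, -⟩ := hnext b hCb
    have ha' := Finset.mem_filter.1 ha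
    have hb' := Finset.mem_filter.1 hb
    have hab : (b : ℕ × ℕ) ∈ C a :=
      Finset.mem_filter.2 ⟨b.2, by rw [← hb'.2.1, ← heq, ha'.2.1], hlt⟩
    exact absurd (hb'.2.2.trans_le (heq ▸ hmin b hab)) (lt_irrefl _)
  obtain ⟨g, hg⟩ := Finset.exists_equiv_extend_of_card_eq (α := A) (t := A) (by simp)
    (s := Finset.univ.filter fun a : A => (C a).Nonempty) (f := next)
    (by
      intro b hb
      obtain ⟨a, ha, rfl⟩ := Finset.mem_image.1 hb
      exact (Finset.mem_filter.1 (hnext a (Finset.mem_filter.1 ha).2).1).1)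
    (by
      intro a ha b hb heq
      have hCa : (C a).Nonempty := (Finset.mem_filter.1 ha).2
      have hCb : (C b).Nonempty := (Finset.mem_filter.1 hb).2
      have ha' := Finset.mem_filter.1 (hnext a hCa).1
      have hb' := Finset.mem_filter.1 (hnext b hCb).1
      have hlev : h a = h b := by rw [← ha'.2.1, heq, hb'.2.1]
      by_contra hne
      rcases h_total a a.2 b b.2 hlev with hle | hle
      · exact h_inj a b hCa hCb heq (lt_of_le_of_ne hle hne)
      · exact h_inj b a hCb hCa heq.symm (lt_of_le_of_ne hle (Ne.symm hne)))
  refine ⟨Equiv.Perm.ofSubtype (p := (· ∈ A)) g,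
    fun a ha => Equiv.Perm.ofSubtype_apply_of_not_mem g ha, fun d => ?_⟩
  rw [← Finset.card_range (finWidth (A ∩ posetPd n d))]
  have mem_Q : ∀ a, a ∈ A ∩ posetPd n d ↔ a ∈ A ∧ d < a.1 ∧ a.2 ≤ d := by
    intro a
    simp only [Finset.mem_inter, posetPd, Finset.mem_filter]
    exact ⟨fun H => ⟨H.1, H.2.2⟩, fun H => ⟨H.1, hAP H.1, H.2⟩⟩
  have h_ends : ∀ a ∈ A ∩ posetPd n d, ∀ b ∈ A ∩ posetPd n d, h a = h b → a < b →
      Equiv.Perm.ofSubtype (p := (· ∈ A)) g a ∈ A ∩ posetPd n d ∧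
        a < Equiv.Perm.ofSubtype (p := (· ∈ A)) g a := by
    intro a ha b hb hab hlt
    have ha' := (mem_Q a).1 ha
    have hb' := (mem_Q b).1 hb
    have hbC : b ∈ C a := Finset.mem_filter.2 ⟨hb'.1, hab.symm, hlt⟩
    obtain ⟨hn, hmin⟩ := hnext ⟨a, ha'.1⟩ ⟨b, hbC⟩
    have hval : Equiv.Perm.ofSubtype (p := (· ∈ A)) g a = next ⟨a, ha'.1⟩ := by
      rw [Equiv.Perm.ofSubtype_apply_of_mem g ha'.1]
      exact hg _ (Finset.mem_filter.2 ⟨Finset.mem_univ _, b, hbC⟩)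
    have hn' := Finset.mem_filter.1 hn
    have hle := hmin b hbC
    rw [hval]
    refine ⟨(mem_Q _).2 ⟨hn'.1, ?_, ?_⟩, hn'.2.2⟩
    · exact ha'.2.1.trans_le hn'.2.2.le.1
    · exact hle.2.trans hb'.2.2
  refine Finset.card_le_card_of_injOn h ?_ ?_
  · intro a ha
    have haQ := (Finset.mem_filter.1 ha).1
    have ha' := (mem_Q a).1 haQ
    refine Finset.mem_coe.2 (Finset.mem_range.2 (finWidth_add_one_le (b := a) ?_ haQ ?_))
    · intro v hv
      simp only [Finset.mem_filter] at hv
      exact (mem_Q v).2 ⟨hv.1, by omega, by omega⟩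
    · intro v hv
      simp only [Finset.mem_filter] at hv
      simp only [Prod.le_def]
      omega
  · intro a ha b hb hab
    obtain ⟨haQ, haE⟩ := Finset.mem_filter.1 ha
    obtain ⟨hbQ, hbE⟩ := Finset.mem_filter.1 hb
    by_contra hne
    rcases h_total a ((mem_Q a).1 haQ).1 b ((mem_Q b).1 hbQ).1 hab with hle | hle
    · exact haE (h_ends a haQ b hbQ hab (lt_of_le_of_ne hle hne))
    · exact hbE (h_ends b hbQ a haQ hab.symm (lt_of_le_of_ne hle (Ne.symm hne)))

/-- In an assignment problem with zero diagonal and positive optimum, some point is moved by every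
optimal permutation. -/
lemma exists_forall_perm_sum_lt {T : Type*} [Fintype T] [DecidableEq T] [Nonempty T]
    (ω : T → T → ℝ) (hω : ∀ a, ω a a = 0) (V : ℝ) (hV : 0 < V)
    (hle : ∀ τ : Equiv.Perm T, ∑ a, ω a (τ a) ≤ V) :
    ∃ δ : T, ∀ σ : Equiv.Perm T, σ δ = δ → ∑ a, ω a (σ a) < V := by
  by_contra! hcon
  choose σ hfix hσ using hcon
  set N : ℝ := (Fintype.card T : ℝ) with hN
  have hN1 : 1 < N := by
    have hpos : 0 < Fintype.card T := Fintype.card_pos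
    have hne : Fintype.card T ≠ 1 := by
      intro h1
      have := Fintype.card_le_one_iff_subsingleton.1 h1.le
      obtain ⟨δ⟩ := ‹Nonempty T›
      have h := hσ δ
      rw [Finset.sum_eq_zero (fun a _ => by rw [Subsingleton.elim (σ δ a) a, hω])] at h
      linarith
    rw [hN]
    exact_mod_cast (by omega : 1 < Fintype.card T)
  have hN0 : 0 < N - 1 := by linarith
  set B : Matrix T T ℝ := fun a b =>
    (N - 1)⁻¹ * (∑ δ, (if σ δ a = b then 1 else 0) - if a = b then 1 else 0) with hB
  have hBmem : B ∈ doublyStochastic ℝ T := by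
    rw [mem_doublyStochastic_iff_sum]
    refine ⟨fun a b => ?_, fun a => ?_, fun b => ?_⟩
    · refine mul_nonneg (inv_nonneg.2 hN0.le) (sub_nonneg.2 ?_)
      by_cases hab : a = b
      · subst hab
        have := Finset.single_le_sum (f := fun δ => if σ δ a = a then (1 : ℝ) else 0)
          (fun δ _ => by positivity) (Finset.mem_univ a)
        simpa [hfix a] using this
      · rw [if_neg hab]
        positivity
    · simp only [hB]
      rw [← Finset.mul_sum, Finset.sum_sub_distrib, Finset.sum_comm]
      simp only [Finset.sum_ite_eq, Finset.mem_univ, if_true, Finset.sum_const, Finset.card_univ,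
        nsmul_eq_mul, mul_one]
      exact inv_mul_cancel₀ hN0.ne'
    · simp only [hB]
      rw [← Finset.mul_sum, Finset.sum_sub_distrib, Finset.sum_comm]
      simp only [← Equiv.eq_symm_apply]
      simp only [Finset.sum_ite_eq', Finset.mem_univ, if_true, Finset.sum_const, Finset.card_univ,
        nsmul_eq_mul, mul_one]
      exact inv_mul_cancel₀ hN0.ne'
  have hlow : (N - 1)⁻¹ * (N * V) ≤ ∑ a, ∑ b, ω a b * B a b := by
    have heq : ∑ a, ∑ b, ω a b * B a b = (N - 1)⁻¹ * ∑ δ, ∑ a, ω a (σ δ a) := by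
      have hrow : ∀ a, ∑ b, ω a b * B a b = (N - 1)⁻¹ * ∑ δ, ω a (σ δ a) := by
        intro a
        simp only [hB]
        simp_rw [mul_left_comm (ω a _), ← Finset.mul_sum, mul_sub, Finset.sum_sub_distrib,
          Finset.mul_sum]
        rw [Finset.sum_comm]
        simp [hω, Finset.mul_sum]
      simp_rw [hrow]
      rw [← Finset.mul_sum, Finset.sum_comm]
    rw [heq]
    refine mul_le_mul_of_nonneg_left ?_ (inv_nonneg.2 hN0.le)
    have := Finset.card_nsmul_le_sum Finset.univ (fun δ => ∑ a, ω a (σ δ a)) V (fun δ _ => hσ δ)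
    simpa [hN] using this
  obtain ⟨w, hw0, hw1, hwB⟩ := exists_eq_sum_perm_of_mem_doublyStochastic hBmem
  have hup : ∑ a, ∑ b, ω a b * B a b ≤ V := by
    have heq : ∑ a, ∑ b, ω a b * B a b = ∑ τ, w τ * ∑ a, ω a (τ a) := by
      rw [← hwB]
      simp only [Matrix.sum_apply, Matrix.smul_apply, Equiv.Perm.permMatrix,
        PEquiv.toMatrix_apply, Equiv.toPEquiv_apply, Option.mem_some_iff, smul_eq_mul,
        Finset.mul_sum]
      have : ∀ a, ∑ b, ∑ τ : Equiv.Perm T, ω a b * (w τ * if τ a = b then 1 else 0) =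
          ∑ τ : Equiv.Perm T, w τ * ω a (τ a) := by
        intro a
        rw [Finset.sum_comm]
        refine Finset.sum_congr rfl fun τ _ => ?_
        simp [mul_comm]
      simp_rw [this]
      exact Finset.sum_comm
    rw [heq]
    calc ∑ τ, w τ * ∑ a, ω a (τ a) ≤ ∑ τ, w τ * V :=
          Finset.sum_le_sum fun τ _ => mul_le_mul_of_nonneg_left (hle τ) (hw0 τ)
      _ = V := by rw [← Finset.sum_mul, hw1, one_mul]
  have hfin := hlow.trans hup
  rw [inv_mul_le_iff₀ hN0] at hfin
  linarith

/-- The lattice points are characterised by the integral form of the inequalities. -/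
lemma mem_latticeS_iff {n : ℕ} {m : ℕ → ℕ} {M : ℕ} {x : ℕ × ℕ → ℤ} :
    x ∈ latticeS n m M ↔ (∀ α, α ∉ posetP n → x α = 0) ∧ (∀ α, 0 ≤ x α) ∧
      ∀ A ⊆ posetP n, ∑ α ∈ A, x α ≤
        (M : ℤ) + ∑ d ∈ Finset.Icc 1 (n - 1), (m d : ℤ) * (finWidth (A ∩ posetPd n d) : ℤ) := by
  simp only [latticeS, polytopeX, Set.mem_ofPred_eq]
  norm_cast

/-- If `x(A) - ∑ m_d w(A ∩ P_d)` has positive maximum `V` over `A ⊆ P`, then some element of `P`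
lies in all the maximizers. -/
lemma exists_mem_all_maximizers (n : ℕ) (hP : (posetP n).Nonempty) (D : Finset ℕ) (m : ℕ → ℕ)
    (x : ℕ × ℕ → ℤ) (V : ℤ) (hV : 0 < V)
    (hle : ∀ A ⊆ posetP n, ∑ α ∈ A, x α ≤ V + ∑ d ∈ D, (m d : ℤ) * finWidth (A ∩ posetPd n d)) :
    ∃ δ ∈ posetP n, ∀ A ⊆ posetP n, δ ∉ A →
      ∑ α ∈ A, x α < V + ∑ d ∈ D, (m d : ℤ) * finWidth (A ∩ posetPd n d) := by
  classical
  by_contra! hcon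
  set ρ : ℕ × ℕ → ℕ × ℕ → ℤ := fun a b => x a - ∑ d ∈ D, (m d : ℤ) *
    if a ∈ posetPd n d ∧ ¬ (b ∈ posetPd n d ∧ a < b) then 1 else 0 with hρ
  set ω : ℕ × ℕ → ℕ × ℕ → ℤ := fun a b => if a = b then 0 else ρ a b with hω
  have h_sum : ∀ (A : Finset (ℕ × ℕ)) (σ : ℕ × ℕ → ℕ × ℕ), (∀ a ∈ A, σ a ∈ A) →
      ∑ a ∈ A, ρ a (σ a) = ∑ a ∈ A, x a - ∑ d ∈ D, (m d : ℤ) *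
        ((A ∩ posetPd n d).filter fun a => ¬ (σ a ∈ A ∩ posetPd n d ∧ a < σ a)).card := by
    intro A σ hσ
    simp only [hρ, Finset.sum_sub_distrib]
    rw [Finset.sum_comm]
    congr 1
    refine Finset.sum_congr rfl fun d _ => ?_
    rw [← Finset.mul_sum, Finset.sum_boole]
    congr 3
    ext a
    simp only [Finset.mem_filter, Finset.mem_inter]
    have := hσ a
    tauto
  have h_diag : ∀ a ∈ posetP n, ρ a a ≤ 0 := by
    intro δ hδ
    obtain ⟨A, hA, hδA, hval⟩ := hcon δ hδ
    have h1 := hle (insert δ A) (Finset.insert_subset hδ hA)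
    rw [Finset.sum_insert hδA] at h1
    have h2 : ∑ d ∈ D, (m d : ℤ) * finWidth (insert δ A ∩ posetPd n d) ≤
        ∑ d ∈ D, (m d : ℤ) * finWidth (A ∩ posetPd n d) +
          ∑ d ∈ D, (m d : ℤ) *
            if δ ∈ posetPd n d ∧ ¬ (δ ∈ posetPd n d ∧ δ < δ) then 1 else 0 := by
      rw [← Finset.sum_add_distrib]
      refine Finset.sum_le_sum fun d _ => ?_
      rw [← mul_add]
      refine mul_le_mul_of_nonneg_left ?_ (by positivity)
      by_cases hd : δ ∈ posetPd n d
      · rw [Finset.insert_inter_of_mem hd, if_pos ⟨hd, fun h => lt_irrefl _ h.2⟩]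
        exact_mod_cast finWidth_insert_le δ _
      · rw [Finset.insert_inter_of_notMem hd, if_neg fun h => hd h.1, add_zero]
    simp only [hρ]
    linarith
  have h_upper : ∀ τ : Equiv.Perm (ℕ × ℕ), (∀ a ∈ posetP n, τ a ∈ posetP n) →
      ∑ a ∈ posetP n, ω a (τ a) ≤ V := by
    intro τ hτ
    set A := (posetP n).filter fun a => ¬ a = τ a with hA
    have hAτ : ∀ a ∈ A, τ a ∈ A := by
      intro a ha
      obtain ⟨haP, hne⟩ := Finset.mem_filter.1 ha
      exact Finset.mem_filter.2 ⟨hτ a haP, fun h => hne (τ.injective h)⟩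
    have heq : ∑ a ∈ posetP n, ω a (τ a) = ∑ a ∈ A, ρ a (τ a) := by
      rw [hA, Finset.sum_filter]
      refine Finset.sum_congr rfl fun a _ => ?_
      simp only [hω, ite_not]
    have hAle := hle A (Finset.filter_subset _ _)
    have hw : ∑ d ∈ D, (m d : ℤ) * finWidth (A ∩ posetPd n d) ≤ ∑ d ∈ D, (m d : ℤ) *
        ((A ∩ posetPd n d).filter fun a => ¬ (τ a ∈ A ∩ posetPd n d ∧ a < τ a)).card := by
      refine Finset.sum_le_sum fun d _ => mul_le_mul_of_nonneg_left ?_ (by positivity)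
      exact_mod_cast finWidth_le_card_chain_ends _ τ τ.injective
    rw [heq, h_sum A τ hAτ]
    linarith
  have h_lower : ∀ δ ∈ posetP n, ∃ σ : Equiv.Perm (ℕ × ℕ), (∀ a ∈ posetP n, σ a ∈ posetP n) ∧
      (∀ a ∉ posetP n, σ a = a) ∧ σ δ = δ ∧ V ≤ ∑ a ∈ posetP n, ω a (σ a) := by
    intro δ hδ
    obtain ⟨A, hA, hδA, hval⟩ := hcon δ hδ
    obtain ⟨σ, hfix, hσ⟩ := exists_perm_card_chain_ends_le n A hA
    have hAσ : ∀ a ∈ A, σ a ∈ A := by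
      intro a ha
      by_contra hn
      exact hn (by rwa [σ.injective (hfix _ hn)])
    refine ⟨σ, fun a ha => ?_, fun a ha => hfix a fun h => ha (hA h), hfix δ hδA, ?_⟩
    · by_cases haA : a ∈ A
      · exact hA (hAσ a haA)
      · rwa [hfix a haA]
    · have heq : ∑ a ∈ posetP n, ω a (σ a) = ∑ a ∈ A, ω a (σ a) := by
        refine (Finset.sum_subset hA fun a _ haA => ?_).symm
        simp [hω, hfix a haA]
      have hge : ∑ a ∈ A, ρ a (σ a) ≤ ∑ a ∈ A, ω a (σ a) := by
        refine Finset.sum_le_sum fun a ha => ?_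
        simp only [hω]
        split_ifs with h
        · rw [← h]
          exact h_diag a (hA ha)
        · exact le_rfl
      have hw : ∑ d ∈ D, (m d : ℤ) *
          ((A ∩ posetPd n d).filter fun a => ¬ (σ a ∈ A ∩ posetPd n d ∧ a < σ a)).card ≤
          ∑ d ∈ D, (m d : ℤ) * finWidth (A ∩ posetPd n d) := by
        refine Finset.sum_le_sum fun d _ => mul_le_mul_of_nonneg_left ?_ (by positivity)
        exact_mod_cast hσ d
      rw [h_sum A σ hAσ] at hge
      rw [heq]
      linarith
  have : Nonempty (posetP n) := hP.to_subtype
  obtain ⟨δ, hδ⟩ := exists_forall_perm_sum_lt (T := posetP n)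
    (fun a b => ((ω a b : ℤ) : ℝ)) (fun a => by simp [hω]) V (by exact_mod_cast hV) (by
      intro τ
      have h := h_upper (Equiv.Perm.ofSubtype (p := (· ∈ posetP n)) τ) (fun a ha => by
        rw [Equiv.Perm.ofSubtype_apply_of_mem τ ha]
        exact (τ ⟨a, ha⟩).2)
      rw [← Finset.sum_coe_sort] at h
      simp only [Equiv.Perm.ofSubtype_apply_coe] at h
      exact_mod_cast h)
  obtain ⟨σ, hσP, hσfix, hσδ, hσV⟩ := h_lower δ δ.2
  have hiff : ∀ a, σ a ∈ posetP n ↔ a ∈ posetP n := by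
    intro a
    refine ⟨fun h => ?_, hσP a⟩
    by_contra hn
    exact hn (hσfix a hn ▸ h)
  have h := hδ (σ.subtypePerm hiff) (Subtype.ext hσδ)
  simp only [Equiv.Perm.subtypePerm_apply] at h
  rw [← Finset.sum_coe_sort] at hσV
  have h' : ∑ a : posetP n, ω a (σ a) < V := by exact_mod_cast h
  exact absurd hσV (not_le.2 h')

/-- If `x ∈ S_{𝐦,M+1}` but `x ∉ S_{𝐦,M}`, then some coordinate `x_δ` can be decreased by `1` so
that the result lies in `S_{𝐦,M}`. -/
lemma exists_sub_single_mem_latticeS {n : ℕ} (hn : 2 ≤ n) {m : ℕ → ℕ} {M : ℕ} {x : ℕ × ℕ → ℤ}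
    (hx : x ∈ latticeS n m (M + 1)) (hxM : x ∉ latticeS n m M) :
    ∃ δ ∈ posetP n, 1 ≤ x δ ∧ (fun α => x α - if α = δ then 1 else 0) ∈ latticeS n m M := by
  obtain ⟨hsupp, hpos, hle⟩ := mem_latticeS_iff.1 hx
  push_cast at hle
  have hP : (posetP n).Nonempty := by
    refine ⟨(2, 1), ?_⟩
    simp only [posetP, Finset.mem_filter, Finset.mem_product, Finset.mem_range]
    omega
  obtain ⟨δ, hδ, hlt⟩ := exists_mem_all_maximizers n hP (Finset.Icc 1 (n - 1)) m x (M + 1)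
    (by positivity) hle
  have hxδ : 1 ≤ x δ := by
    by_contra hlt1
    have hx0 : x δ = 0 := by
      have := hpos δ
      omega
    refine hxM (mem_latticeS_iff.2 ⟨hsupp, hpos, fun A hA => ?_⟩)
    have h := hlt (A.erase δ) ((Finset.erase_subset _ _).trans hA) (Finset.notMem_erase _ _)
    rw [Finset.sum_erase A hx0] at h
    have hw : ∑ d ∈ Finset.Icc 1 (n - 1), (m d : ℤ) * finWidth (A.erase δ ∩ posetPd n d) ≤
        ∑ d ∈ Finset.Icc 1 (n - 1), (m d : ℤ) * finWidth (A ∩ posetPd n d) := by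
      refine Finset.sum_le_sum fun d _ => mul_le_mul_of_nonneg_left ?_ (by positivity)
      exact_mod_cast finWidth_mono (Finset.inter_subset_inter_right (Finset.erase_subset _ _))
    linarith
  refine ⟨δ, hδ, hxδ, mem_latticeS_iff.2 ⟨fun α hα => ?_, fun α => ?_, fun A hA => ?_⟩⟩
  · have hne : α ≠ δ := fun h => hα (h ▸ hδ)
    simp [hne, hsupp α hα]
  · have := hpos α
    split_ifs with h
    · rw [h]
      omega
    · omega
  · rw [Finset.sum_sub_distrib, Finset.sum_ite_eq']
    split_ifs with h
    · have := hle A hA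
      linarith
    · have := hlt A hA h
      linarith

/-- If `x ∈ S_{𝐦,M+1}` but `x ∉ S_{𝐦,M}`, then some coordinate `x_δ` (with `δ ∈ P`)
can be decreased by `1` so that the result lies in `S_{𝐦,M}`; equivalently,
`S_{𝐦,M} + S_{𝟎,1} = S_{𝐦,M+1}`. -/
theorem statement4 (n : ℕ) (hn : 2 ≤ n) (m : ℕ → ℕ) (M : ℕ) :
    (∀ x ∈ latticeS n m (M + 1), x ∉ latticeS n m M →
      ∃ δ ∈ posetP n, 1 ≤ x δ ∧
        (fun α => x α - if α = δ then 1 else 0) ∈ latticeS n m M) ∧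
    latticeS n m M + latticeS n (fun _ => 0) 1 = latticeS n m (M + 1) := by
  refine ⟨fun x hx hxM => exists_sub_single_mem_latticeS hn hx hxM, Set.Subset.antisymm ?_ ?_⟩
  · rintro _ ⟨x, hx, y, hy, rfl⟩
    obtain ⟨hx1, hx2, hx3⟩ := mem_latticeS_iff.1 hx
    obtain ⟨hy1, hy2, hy3⟩ := mem_latticeS_iff.1 hy
    refine mem_latticeS_iff.2 ⟨fun α hα => ?_, fun α => add_nonneg (hx2 α) (hy2 α),
      fun A hA => ?_⟩
    · simp [hx1 α hα, hy1 α hα]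
    · have h1 := hx3 A hA
      have h2 := hy3 A hA
      simp only [Pi.add_apply, Finset.sum_add_distrib]
      push_cast at h2 ⊢
      simp only [zero_mul, Finset.sum_const_zero] at h2
      linarith
  · intro x hx
    by_cases hxM : x ∈ latticeS n m M
    · refine ⟨x, hxM, 0, mem_latticeS_iff.2 ⟨by simp, by simp, by simp⟩, add_zero x⟩
    · obtain ⟨δ, hδ, -, hmem⟩ := exists_sub_single_mem_latticeS hn hx hxM
      refine ⟨_, hmem, fun α => if α = δ then 1 else 0,
        mem_latticeS_iff.2 ⟨fun α hα => ?_, fun α => ?_, fun A _ => ?_⟩, ?_⟩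
      · have hne : α ≠ δ := fun h => hα (h ▸ hδ)
        simp [hne]
      · split_ifs <;> norm_num
      · rw [Finset.sum_ite_eq']
        split_ifs <;> simp
      · funext α
        simp
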